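/- Let E be a non-trivial regular equational theory and Γ = { s ≈_E^? t } an E-unification problem such that Var(s) ∩ Var(t) = ∅. If Γ has a minimal complete set of E-unifiers w.r.t. the unrestricted instantiation preorder ≤_E^V, then Γ has a minimal complete set of E-unifiers w.r.t. ≤_E^V that is contained in C_E(Γ), the set of all E-unifiers σ of Γ such that for every y ∈ VRan(σ) there exist variables x ≠ x' with y ∈ Var(σ(x)) ∩ Var(σ(x')). -/

import Mathlib

namespace UnifFW

/-- First-order terms over a signature `F` (an arity-indexed family of function
symbols), with variables from the countably infinite set `V = ℕ`. -/
inductive Term (F : ℕ → Type) : Type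
  | var : ℕ → Term F
  | app : (n : ℕ) → F n → (Fin n → Term F) → Term F

variable {F : ℕ → Type}

/-- The set of variables occurring in a term. -/
def Term.vars : Term F → Set ℕ
  | .var x => {x}
  | .app _ _ ts => ⋃ i, (ts i).vars

/-- Homomorphic extension of a map `V → T(Σ,V)` to terms. -/
def Term.subst (σ : ℕ → Term F) : Term F → Term F
  | .var x => σ x
  | .app n f ts => .app n f (fun i => (ts i).subst σ)

/-- The congruence `≈_E` induced by a set `E` of identities: the smallest
equivalence relation containing all substitution instances of identities of `E`
and compatible with the term constructors. -/
inductive EqE (E : Set (Term F × Term F)) : Term F → Term F → Prop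
  | ax {s t : Term F} (σ : ℕ → Term F) : (s, t) ∈ E → EqE E (s.subst σ) (t.subst σ)
  | refl (t : Term F) : EqE E t t
  | symm {s t : Term F} : EqE E s t → EqE E t s
  | trans {s t u : Term F} : EqE E s t → EqE E t u → EqE E s u
  | congr {n : ℕ} (f : F n) {ts us : Fin n → Term F} :
      (∀ i, EqE E (ts i) (us i)) → EqE E (.app n f ts) (.app n f us)

/-- A theory is non-trivial if distinct variables are not equated. -/
def NonTrivial (E : Set (Term F × Term F)) : Prop :=
  ∀ x y : ℕ, x ≠ y → ¬ EqE E (.var x) (.var y)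

/-- A theory is regular if both sides of each identity have the same variables. -/
def Regular (E : Set (Term F × Term F)) : Prop :=
  ∀ p ∈ E, (Prod.fst p).vars = (Prod.snd p).vars

/-- A substitution: a map `V → T(Σ,V)` with finite domain. -/
structure Subst (F : ℕ → Type) where
  toFun : ℕ → Term F
  finite_dom : {x : ℕ | toFun x ≠ Term.var x}.Finite

/-- The domain of a substitution. -/
def Subst.Dom (σ : Subst F) : Set ℕ := {x : ℕ | σ.toFun x ≠ Term.var x}

/-- The variable range of a substitution: all variables occurring in the images
of domain variables. -/
def Subst.VRan (σ : Subst F) : Set ℕ := ⋃ x ∈ σ.Dom, (σ.toFun x).vars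

/-- The instantiation preorder `σ ≤_E^X θ`: some substitution `λ` satisfies
`λ(σ(x)) ≈_E θ(x)` for all `x ∈ X`. -/
def InstLE (E : Set (Term F × Term F)) (X : Set ℕ) (σ θ : Subst F) : Prop :=
  ∃ lam : Subst F, ∀ x ∈ X, EqE E ((σ.toFun x).subst lam.toFun) (θ.toFun x)

/-- The equivalence `σ ∼_E^X θ` induced by the instantiation preorder. -/
def InstEquiv (E : Set (Term F × Term F)) (X : Set ℕ) (σ θ : Subst F) : Prop :=
  InstLE E X σ θ ∧ InstLE E X θ σ

/-- The strict instantiation order `σ <_E^X θ`. -/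
def InstLT (E : Set (Term F × Term F)) (X : Set ℕ) (σ θ : Subst F) : Prop :=
  InstLE E X σ θ ∧ ¬ InstLE E X θ σ

/-- The set of variables occurring in a unification problem. -/
def VarsP (Γ : Set (Term F × Term F)) : Set ℕ :=
  ⋃ p ∈ Γ, (Prod.fst p).vars ∪ (Prod.snd p).vars

/-- `σ` is an `E`-unifier of the unification problem `Γ`. -/
def Unifier (E Γ : Set (Term F × Term F)) (σ : Subst F) : Prop :=
  ∀ p ∈ Γ, EqE E ((Prod.fst p).subst σ.toFun) ((Prod.snd p).subst σ.toFun)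

/-- A unification problem is solvable if it has a unifier. -/
def Solvable (E Γ : Set (Term F × Term F)) : Prop := ∃ σ : Subst F, Unifier E Γ σ

/-- `S` is a complete set of `E`-unifiers of `Γ` w.r.t. `≤_E^X`. -/
def CompleteSet (E Γ : Set (Term F × Term F)) (X : Set ℕ) (S : Set (Subst F)) : Prop :=
  (∀ σ ∈ S, Unifier E Γ σ) ∧ ∀ θ : Subst F, Unifier E Γ θ → ∃ σ ∈ S, InstLE E X σ θ

/-- `S` is a minimal complete set of `E`-unifiers of `Γ` w.r.t. `≤_E^X`:
complete, and no two distinct elements are comparable. -/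
def MinimalComplete (E Γ : Set (Term F × Term F)) (X : Set ℕ) (S : Set (Subst F)) : Prop :=
  CompleteSet E Γ X S ∧ ∀ σ ∈ S, ∀ θ ∈ S, σ ≠ θ → ¬ InstLE E X σ θ

/-- `Γ` has unification type unitary w.r.t. `≤_E^X`. -/
def TypeUnitary (E Γ : Set (Term F × Term F)) (X : Set ℕ) : Prop :=
  ∃ σ : Subst F, MinimalComplete E Γ X {σ}

/-- `Γ` has unification type finitary w.r.t. `≤_E^X`. -/
def TypeFinitary (E Γ : Set (Term F × Term F)) (X : Set ℕ) : Prop :=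
  ∃ S : Set (Subst F), MinimalComplete E Γ X S ∧ S.Finite ∧ 1 < S.ncard

/-- `Γ` has unification type infinitary w.r.t. `≤_E^X`. -/
def TypeInfinitary (E Γ : Set (Term F × Term F)) (X : Set ℕ) : Prop :=
  ∃ S : Set (Subst F), MinimalComplete E Γ X S ∧ S.Infinite

/-- `Γ` has unification type zero w.r.t. `≤_E^X`. -/
def TypeZero (E Γ : Set (Term F × Term F)) (X : Set ℕ) : Prop :=
  ¬ ∃ S : Set (Subst F), MinimalComplete E Γ X S

/-- `σ` is a `≤_E^X`-minimal `E`-unifier of `Γ`. -/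
def MinUnifier (E Γ : Set (Term F × Term F)) (X : Set ℕ) (σ : Subst F) : Prop :=
  Unifier E Γ σ ∧ ∀ θ : Subst F, Unifier E Γ θ → InstLE E X θ σ → InstLE E X σ θ

/-- The set `C_E(Γ)` of unifiers all of whose range variables occur in the
images of at least two distinct variables. -/
def CSet (E Γ : Set (Term F × Term F)) : Set (Subst F) :=
  {σ : Subst F | Unifier E Γ σ ∧
    ∀ y ∈ σ.VRan, ∃ x x' : ℕ, x ≠ x' ∧ y ∈ (σ.toFun x).vars ∩ (σ.toFun x').vars}

/-- `E` is Noetherian w.r.t. the unrestricted instantiation preorder: there is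
no infinite strictly descending chain `σ₁ >_E^V σ₂ >_E^V ⋯`. -/
def Noetherian (E : Set (Term F × Term F)) : Prop :=
  ¬ ∃ f : ℕ → Subst F, ∀ n : ℕ, InstLT E Set.univ (f (n + 1)) (f n)


theorem Term.subst_subst (σ τ : ℕ → Term F) (u : Term F) :
    (u.subst σ).subst τ = u.subst fun x => (σ x).subst τ := by
  induction u with
  | var x => rfl
  | app n f ts ih => simp [Term.subst, ih]

theorem Term.subst_var (u : Term F) : u.subst Term.var = u := by
  induction u with
  | var x => rfl
  | app n f ts ih => simp [Term.subst, ih]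

theorem Term.subst_congr {σ τ : ℕ → Term F} (u : Term F) (h : ∀ x ∈ u.vars, σ x = τ x) :
    u.subst σ = u.subst τ := by
  induction u with
  | var x => exact h x rfl
  | app n f ts ih =>
    simp only [Term.subst, Term.app.injEq, heq_eq_eq, true_and]
    exact funext fun i => ih i fun x hx => h x (Set.mem_iUnion.2 ⟨i, hx⟩)

theorem Term.mem_vars_subst (σ : ℕ → Term F) (u : Term F) (y : ℕ) :
    y ∈ (u.subst σ).vars ↔ ∃ x ∈ u.vars, y ∈ (σ x).vars := by
  induction u with
  | var x => simp [Term.subst, Term.vars]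
  | app n f ts ih =>
    simp only [Term.subst, Term.vars, Set.mem_iUnion, ih]
    exact ⟨fun ⟨i, x, hx, hy⟩ => ⟨x, ⟨i, hx⟩, hy⟩, fun ⟨x, ⟨i, hx⟩, hy⟩ => ⟨i, x, hx, hy⟩⟩

theorem EqE.subst {E : Set (Term F × Term F)} {u v : Term F} (h : EqE E u v)
    (τ : ℕ → Term F) : EqE E (u.subst τ) (v.subst τ) := by
  induction h with
  | ax σ h =>
    rw [Term.subst_subst, Term.subst_subst]
    exact .ax _ h
  | refl t => exact .refl _
  | symm _ ih => exact ih.symm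
  | trans _ _ ih₁ ih₂ => exact ih₁.trans ih₂
  | congr f _ ih => exact .congr f ih

theorem Regular.vars_eq {E : Set (Term F × Term F)} (hreg : Regular E) {u v : Term F}
    (h : EqE E u v) : u.vars = v.vars := by
  induction h with
  | ax σ h =>
    ext y
    rw [Term.mem_vars_subst, Term.mem_vars_subst, hreg _ h]
  | refl t => rfl
  | symm _ ih => exact ih.symm
  | trans _ _ ih₁ ih₂ => exact ih₁.trans ih₂
  | congr f _ ih => simp only [Term.vars, ih]

theorem InstLE.refl (E : Set (Term F × Term F)) (X : Set ℕ) (σ : Subst F) :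
    InstLE E X σ σ :=
  ⟨⟨Term.var, by simp⟩, fun x _ => by simpa only [Term.subst_var] using EqE.refl _⟩

theorem InstLE.trans {E : Set (Term F × Term F)} {X : Set ℕ} {σ τ θ : Subst F}
    (h₁ : InstLE E X σ τ) (h₂ : InstLE E X τ θ) : InstLE E X σ θ := by
  obtain ⟨l₁, h₁⟩ := h₁
  obtain ⟨l₂, h₂⟩ := h₂
  refine ⟨⟨fun x => (l₁.toFun x).subst l₂.toFun, ?_⟩, fun x hx => ?_⟩
  · refine (l₁.finite_dom.union l₂.finite_dom).subset fun x hx => ?_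
    by_contra hn
    simp only [Set.mem_union, Set.mem_ofPred_eq, not_or, not_not] at hn
    exact hx (by simp [hn.1, hn.2, Term.subst])
  · have h := ((h₁ x hx).subst l₂.toFun).trans (h₂ x hx)
    rwa [Term.subst_subst] at h

/-- A variable `y` in the range of `σ` that occurs only in `σ x`, where `x` does not occur in the
unification problem, can be used to remove `x` from the domain of `σ` by passing to a more
general unifier. -/
theorem exists_instLE_dom_ssubset (E : Set (Term F × Term F)) {s t : Term F} {σ : Subst F}
    (hσ : Unifier E {(s, t)} σ) {x y : ℕ} (hx : x ∈ σ.Dom) (hs : x ∉ s.vars) (ht : x ∉ t.vars)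
    (hy : ∀ z, z ≠ x → y ∉ (σ.toFun z).vars) :
    ∃ c : Subst F, Unifier E {(s, t)} c ∧ InstLE E Set.univ c σ ∧ c.Dom ⊂ σ.Dom := by
  set r : ℕ → Term F := Function.update Term.var x (.var y) with hr
  set g : ℕ → Term F := Function.update (fun z => (σ.toFun z).subst r) x (.var x) with hg
  have hdom : {z | g z ≠ Term.var z} ⊆ σ.Dom := by
    intro z hz hzσ
    by_cases hzx : z = x
    · exact hz (by simp [hg, hzx])
    · exact hz (by simp [hg, hr, hzx, hzσ, Term.subst])
  have hgr {u : Term F} (hu : x ∉ u.vars) : u.subst g = (u.subst σ.toFun).subst r := by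
    rw [Term.subst_subst]
    refine u.subst_congr fun z hz => ?_
    rw [hg, Function.update_of_ne (ne_of_mem_of_not_mem hz hu)]
  refine ⟨⟨g, σ.finite_dom.subset hdom⟩, ?_, ?_, hdom, fun h => h hx (by simp [hg])⟩
  · rintro p rfl
    simpa only [hgr hs, hgr ht] using (hσ _ rfl).subst r
  · refine ⟨⟨Function.update (Function.update Term.var y (.var x)) x (σ.toFun x), ?_⟩,
      fun z _ => ?_⟩
    · refine (Set.toFinite {x, y}).subset fun z hz => ?_
      by_contra hn
      simp only [Set.mem_insert_iff, Set.mem_singleton_iff, not_or] at hn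
      exact hz (by simp [hn.1, hn.2])
    · by_cases hzx : z = x
      · simpa [hg, hzx, Term.subst] using EqE.refl _
      · have h : ((σ.toFun z).subst r).subst
            (Function.update (Function.update Term.var y (.var x)) x (σ.toFun x)) =
            σ.toFun z := by
          rw [Term.subst_subst]
          conv_rhs => rw [← Term.subst_var (σ.toFun z)]
          refine Term.subst_congr _ fun w hw => ?_
          have hwy : w ≠ y := fun h => hy z hzx (h ▸ hw)
          by_cases hwx : w = x
          · subst hwx
            simp [hr, Term.subst, hwy.symm]
          · simp [hr, Term.subst, hwx, hwy]
        simpa only [hg, Function.update_of_ne hzx, h] using EqE.refl _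

theorem exists_mem_CSet_instLE {E : Set (Term F × Term F)} (hreg : Regular E) {s t : Term F}
    (hd : s.vars ∩ t.vars = ∅) (σ : Subst F) (hσ : Unifier E {(s, t)} σ) :
    ∃ c ∈ CSet E {(s, t)}, InstLE E Set.univ c σ := by
  induction hn : σ.Dom.ncard using Nat.strong_induction_on generalizing σ with
  | _ n ih =>
  by_cases hc : σ ∈ CSet E {(s, t)}
  · exact ⟨σ, hc, .refl _ _ _⟩
  obtain ⟨y, hyR, hy⟩ : ∃ y ∈ σ.VRan, ∀ x x', x ≠ x' →
      y ∈ (σ.toFun x).vars → y ∉ (σ.toFun x').vars := by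
    by_contra! h
    exact hc ⟨hσ, fun y hy => by simpa [Set.mem_inter_iff] using h y hy⟩
  simp only [Subst.VRan, Set.mem_iUnion] at hyR
  obtain ⟨x, hx, hyx⟩ := hyR
  have hne {z : ℕ} (hz : y ∈ (σ.toFun z).vars) : z = x := by
    by_contra hzx
    exact hy x z (Ne.symm hzx) hyx hz
  have hvars := hreg.vars_eq (hσ _ rfl)
  have hnot : ¬ (x ∈ s.vars ∧ x ∈ t.vars) := fun h => by
    have : x ∈ s.vars ∩ t.vars := h
    simp [hd] at this
  have hiff : x ∈ s.vars ↔ x ∈ t.vars := by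
    have key (u : Term F) : x ∈ u.vars ↔ y ∈ (u.subst σ.toFun).vars := by
      rw [Term.mem_vars_subst]
      exact ⟨fun h => ⟨x, h, hyx⟩, fun ⟨z, hz, hyz⟩ => hne hyz ▸ hz⟩
    rw [key, key, hvars]
  obtain ⟨c, hcU, hcσ, hcd⟩ := exists_instLE_dom_ssubset E hσ hx
    (fun h => hnot ⟨h, hiff.1 h⟩) (fun h => hnot ⟨hiff.2 h, h⟩) fun z hz h => hz (hne h)
  obtain ⟨d, hd, hdc⟩ := ih _ (hn ▸ Set.ncard_lt_ncard hcd σ.finite_dom) c hcU rfl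
  exact ⟨d, hd, hdc.trans hcσ⟩

/-- Lemma `complete:lem`: for a non-trivial regular theory
`E` and `Γ = {s ≈ t}` with `Var(s) ∩ Var(t) = ∅`, if `Γ` has a minimal
complete set of `E`-unifiers w.r.t. `≤_E^V`, then it has one contained in
`C_E(Γ)`. -/
theorem stmt5 {F : ℕ → Type} (E : Set (Term F × Term F)) (hE : NonTrivial E)
    (hreg : Regular E) (s t : Term F) (hd : s.vars ∩ t.vars = ∅)
    (h : ∃ S : Set (Subst F), MinimalComplete E {(s, t)} Set.univ S) :
    ∃ S : Set (Subst F), MinimalComplete E {(s, t)} Set.univ S ∧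
      S ⊆ CSet E {(s, t)} := by
  obtain ⟨S, ⟨hSU, hSc⟩, hSm⟩ := h
  choose! c hcC hcle using fun (σ : Subst F) (hσ : σ ∈ S) =>
    exists_mem_CSet_instLE hreg hd σ (hSU σ hσ)
  refine ⟨c '' S, ⟨⟨?_, fun θ hθ => ?_⟩, ?_⟩, ?_⟩
  · rintro _ ⟨σ, hσ, rfl⟩
    exact (hcC σ hσ).1
  · obtain ⟨σ, hσ, hle⟩ := hSc θ hθ
    exact ⟨c σ, ⟨σ, hσ, rfl⟩, (hcle σ hσ).trans hle⟩
  · rintro _ ⟨σ, hσ, rfl⟩ _ ⟨τ, hτ, rfl⟩ hne hle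
    obtain ⟨ρ, hρ, hρle⟩ := hSc (c σ) (hcC σ hσ).1
    have hρσ : ρ = σ := by
      by_contra h
      exact hSm ρ hρ σ hσ h (hρle.trans (hcle σ hσ))
    subst hρσ
    exact hSm ρ hρ τ hτ (fun h => hne (h ▸ rfl)) ((hρle.trans hle).trans (hcle τ hτ))
  · rintro _ ⟨σ, hσ, rfl⟩
    exact hcC σ hσ
end UnifFW
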